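/- arXiv:1305.5043 — 2 statements merged into one kernel-verified Lean document; each statement's English description precedes it below -/
import Mathlib

section
/- Let g = g₀ ⊕ g₁ be a finite-dimensional complex Lie superalgebra of basic type, h a Cartan subalgebra of g₀, and decompose g = h + [g₀,g₀] ⊕ Σ_λ V(λ) as a direct sum of irreducible g₀-modules V(λ) of highest weight λ. Set h' = h ∩ [g,g]. If some summand V(λ) in this decomposition is one-dimensional, then λ vanishes on h'. -/
open scoped BigOperators Classical
open Module

noncomputable section

/-- A complex Lie superalgebra structure on `L`: a `ℤ/2`-grading `L = g0 ⊕ g1`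
together with a bilinear bracket which preserves the grading, is
super-skew-symmetric and satisfies the super Jacobi identity. -/
structure SuperData (L : Type*) [AddCommGroup L] [Module ℂ L] where
  g0 : Submodule ℂ L
  g1 : Submodule ℂ L
  compl : IsCompl g0 g1
  br : L →ₗ[ℂ] L →ₗ[ℂ] L
  br00 : ∀ x ∈ g0, ∀ y ∈ g0, br x y ∈ g0
  br01 : ∀ x ∈ g0, ∀ y ∈ g1, br x y ∈ g1
  br10 : ∀ x ∈ g1, ∀ y ∈ g0, br x y ∈ g1
  br11 : ∀ x ∈ g1, ∀ y ∈ g1, br x y ∈ g0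
  skew_e : ∀ x ∈ g0, ∀ y : L, br x y = - br y x
  skew_o : ∀ x ∈ g1, ∀ y ∈ g1, br x y = br y x
  jac_e : ∀ x ∈ g0, ∀ y z : L, br x (br y z) = br (br x y) z + br y (br x z)
  jac_oe : ∀ x ∈ g1, ∀ y ∈ g0, ∀ z : L, br x (br y z) = br (br x y) z + br y (br x z)
  jac_oo : ∀ x ∈ g1, ∀ y ∈ g1, ∀ z : L, br x (br y z) = br (br x y) z - br y (br x z)

namespace SuperData

variable {L : Type*} [AddCommGroup L] [Module ℂ L] (S : SuperData L)

/-- The span of all brackets `[P, Q]`. -/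
def brSpan (P Q : Submodule ℂ L) : Submodule ℂ L :=
  Submodule.span ℂ {z : L | ∃ x ∈ P, ∃ y ∈ Q, S.br x y = z}

/-- The derived subalgebra `g⁽¹⁾ = [g, g]`. -/
def derived : Submodule ℂ L := S.brSpan ⊤ ⊤

/-- The second derived subalgebra `g⁽²⁾ = [[g,g],[g,g]]`. -/
def derived2 : Submodule ℂ L := S.brSpan S.derived S.derived

/-- The center `𝔷(g)` of the Lie superalgebra. -/
def center : Submodule ℂ L := ⨅ y : L, LinearMap.ker (S.br.flip y)

/-- Ideals of the Lie superalgebra. -/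
def IsIdeal (I : Submodule ℂ L) : Prop := ∀ x : L, ∀ y ∈ I, S.br x y ∈ I

/-- `ℤ/2`-graded subspaces. -/
def IsGraded (I : Submodule ℂ L) : Prop := I = I ⊓ S.g0 ⊔ I ⊓ S.g1

/-- Subalgebras (bracket-closed subspaces). -/
def IsSubalgebra (W : Submodule ℂ L) : Prop := ∀ x ∈ W, ∀ y ∈ W, S.br x y ∈ W

/-- A Cartan subalgebra of the reductive even part `g0`:
an abelian self-normalizing subalgebra of `g0`. -/
def IsCartan (h : Submodule ℂ L) : Prop :=
  h ≤ S.g0 ∧ (∀ x ∈ h, ∀ y ∈ h, S.br x y = 0) ∧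
    ∀ x ∈ S.g0, (∀ y ∈ h, S.br x y ∈ h) → x ∈ h

/-- The weight space of weight `α` relative to the Cartan subalgebra `h`,
inside the `h`-stable subspace `W`. -/
def wsp (h W : Submodule ℂ L) (α : Module.Dual ℂ L) : Submodule ℂ L :=
  W ⊓ ⨅ t : h, LinearMap.ker (S.br (t : L) - α (t : L) • (LinearMap.id : L →ₗ[ℂ] L))

/-- The superdimension `sdim W = dim W₀ - dim W₁` of a subspace. -/
def sdim (W : Submodule ℂ L) : ℤ :=
  (Module.finrank ℂ ↥(W ⊓ S.g0) : ℤ) - (Module.finrank ℂ ↥(W ⊓ S.g1) : ℤ)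

/-- The Casimir operator `Ω_g(a) = ∑ i [xⁱ,[x_i,a]]` attached to a pair of
dual bases `{x_i}`, `{xⁱ}`. -/
def casimir {ι : Type*} [Fintype ι] (b d : ι → L) : L →ₗ[ℂ] L :=
  ∑ i, (S.br (d i)) ∘ₗ (S.br (b i))

end SuperData

/-- A quadratic Lie superalgebra: a Lie superalgebra with a nondegenerate
invariant supersymmetric bilinear form. -/
structure QuadSuperData (L : Type*) [AddCommGroup L] [Module ℂ L] extends SuperData L where
  B : L →ₗ[ℂ] L →ₗ[ℂ] ℂ
  B_symm : ∀ x ∈ g0, ∀ y ∈ g0, B x y = B y x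
  B_alt : ∀ x ∈ g1, ∀ y ∈ g1, B x y = - B y x
  B_ortho : ∀ x ∈ g0, ∀ y ∈ g1, B x y = 0
  B_nondeg : ∀ x : L, (∀ y : L, B x y = 0) → x = 0
  B_inv : ∀ x y z : L, B (br x y) z = B x (br y z)

namespace QuadSuperData

variable {L : Type*} [AddCommGroup L] [Module ℂ L] (S : QuadSuperData L)

/-- Isotropic subspaces for the invariant form. -/
def IsIsotropic (W : Submodule ℂ L) : Prop := ∀ x ∈ W, ∀ y ∈ W, S.B x y = 0

/-- Maximal isotropic subspaces for the invariant form. -/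
def IsMaxIsotropic (W : Submodule ℂ L) : Prop :=
  S.IsIsotropic W ∧ ∀ W' : Submodule ℂ L, S.IsIsotropic W' → W ≤ W' → W' = W

end QuadSuperData

/-- A Lie superalgebra of basic type: quadratic, and `g0` is a reductive
subalgebra of `g`, i.e. the adjoint action of `g0` on `g` is completely
reducible. -/
structure BasicSuperData (L : Type*) [AddCommGroup L] [Module ℂ L] extends QuadSuperData L where
  reductive : ∀ W : Submodule ℂ L, (∀ x ∈ g0, ∀ w ∈ W, br x w ∈ W) →
    ∃ W' : Submodule ℂ L, (∀ x ∈ g0, ∀ w ∈ W', br x w ∈ W') ∧ IsCompl W W'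

/-- A vector of a complex vector space equal to its negative vanishes. -/
theorem eq_zero_of_eq_neg {L : Type*} [AddCommGroup L] [Module ℂ L] {v : L} (hv : v = -v) :
    v = 0 := by
  have : IsAddTorsionFree L := .of_isTorsionFree ℂ L
  exact self_eq_neg.1 hv

namespace QuadSuperData

variable {L : Type*} [AddCommGroup L] [Module ℂ L] (S : QuadSuperData L)

/-- An even element pairing to zero with every even element vanishes. -/
theorem eq_zero_of_even {v : L} (hv : v ∈ S.g0) (hB : ∀ x ∈ S.g0, S.B x v = 0) : v = 0 := by
  refine S.B_nondeg v fun y => ?_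
  obtain ⟨y0, hy0, y1, hy1, rfl⟩ := Submodule.mem_sup.1
    (S.compl.sup_eq_top ▸ Submodule.mem_top : y ∈ S.g0 ⊔ S.g1)
  rw [map_add, S.B_symm v hv y0 hy0, hB y0 hy0, S.B_ortho v hv y1 hy1, add_zero]

/-- The invariant form pairs every nonzero odd element nontrivially with some odd element. -/
theorem exists_odd_pairing_eq_one [FiniteDimensional ℂ L] {w : L} (hw : w ∈ S.g1) (hw0 : w ≠ 0) :
    ∃ u ∈ S.g1, S.B w u = 1 := by
  have hinj : Function.Injective S.B := by
    rw [injective_iff_map_eq_zero]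
    exact fun x hx => S.B_nondeg x fun y => by rw [hx, LinearMap.zero_apply]
  have hsurj : Function.Surjective S.B :=
    (LinearMap.injective_iff_surjective_of_finrank_eq_finrank
      (Subspace.dual_finrank_eq (K := ℂ) (V := L)).symm).1 hinj
  obtain ⟨f, hf⟩ : ∃ f : Module.Dual ℂ L, f w ≠ 0 := by
    by_contra! hcon
    exact hw0 ((Module.forall_dual_apply_eq_zero_iff ℂ w).1 hcon)
  obtain ⟨y, rfl⟩ := hsurj f
  obtain ⟨y0, hy0, y1, hy1, rfl⟩ := Submodule.mem_sup.1
    (S.compl.sup_eq_top ▸ Submodule.mem_top : y ∈ S.g0 ⊔ S.g1)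
  rw [map_add, LinearMap.add_apply, S.B_ortho y0 hy0 w hw, zero_add, S.B_alt y1 hy1 w hw,
    neg_ne_zero] at hf
  exact ⟨(S.B w y1)⁻¹ • y1, S.g1.smul_mem _ hy1, by
    rw [map_smul, smul_eq_mul, inv_mul_cancel₀ hf]⟩

end QuadSuperData

namespace BasicSuperData

variable {L : Type*} [AddCommGroup L] [Module ℂ L] (S : BasicSuperData L)

/-- An even element commuting with `g0` whose adjoint action squares to zero is central. -/
theorem br_eq_zero_of_sq_eq_zero {z : L} (hz : z ∈ S.g0) (hcomm : ∀ x ∈ S.g0, S.br z x = 0)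
    (hsq : ∀ a : L, S.br z (S.br z a) = 0) (a : L) : S.br z a = 0 := by
  obtain ⟨K, hK, hKc⟩ := S.reductive (LinearMap.ker (S.br z)) fun x hx v hv => by
    rw [LinearMap.mem_ker] at hv ⊢
    rw [S.jac_e z hz x v, hcomm x hx, hv, map_zero, map_zero, LinearMap.zero_apply, add_zero]
  obtain ⟨p, hp, k, hk, rfl⟩ := Submodule.mem_sup.1
    (hKc.sup_eq_top ▸ Submodule.mem_top : a ∈ LinearMap.ker (S.br z) ⊔ K)
  rw [map_add, LinearMap.mem_ker.1 hp, zero_add]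
  exact Submodule.disjoint_def.1 hKc.disjoint _ (LinearMap.mem_ker.2 (hsq k)) (hK z hz k hk)

/-- An even vector spanning a one-dimensional `g0`-submodule is centralized by `g0`. -/
theorem br_even_eq_zero {w : L} (hw : w ∈ S.g0)
    (hχ : ∀ x ∈ S.g0, ∃ c : ℂ, S.br x w = c • w) {t : L} (ht : t ∈ S.g0) : S.br t w = 0 := by
  have hww : S.br w w = 0 := eq_zero_of_eq_neg (S.skew_e w hw w)
  obtain ⟨K, hK, hKc⟩ := S.reductive (ℂ ∙ w) fun x hx v hv => by
    obtain ⟨a, rfl⟩ := Submodule.mem_span_singleton.1 hv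
    obtain ⟨c, hc⟩ := hχ x hx
    rw [map_smul, hc]
    exact Submodule.smul_mem _ _ (Submodule.smul_mem _ _ (Submodule.mem_span_singleton_self w))
  obtain ⟨p, hp, k, hk, rfl⟩ := Submodule.mem_sup.1
    (hKc.sup_eq_top ▸ Submodule.mem_top : t ∈ (ℂ ∙ w) ⊔ K)
  obtain ⟨a, rfl⟩ := Submodule.mem_span_singleton.1 hp
  have hk0 : k ∈ S.g0 := (Submodule.add_mem_iff_right _ (S.g0.smul_mem a hw)).1 ht
  have hkw : S.br k w = 0 := by
    refine Submodule.disjoint_def.1 hKc.disjoint _ ?_ ?_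
    · obtain ⟨c, hc⟩ := hχ k hk0
      exact hc ▸ Submodule.smul_mem _ _ (Submodule.mem_span_singleton_self w)
    · rw [S.skew_e k hk0 w]
      exact K.neg_mem (hK w hw k hk)
  rw [map_add, map_smul, LinearMap.add_apply, LinearMap.smul_apply, hww, hkw, smul_zero, add_zero]

/-- If an odd vector `w` spans a one-dimensional `g0`-submodule, then its bracket with an odd
vector dual to it is central. -/
theorem br_br_odd_eq_zero {w u : L} (hw : w ∈ S.g1) (hu : u ∈ S.g1)
    (hwu : S.B w u = 1) (hχ : ∀ x ∈ S.g0, ∃ c : ℂ, S.br x w = c • w) (a : L) :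
    S.br (S.br w u) a = 0 := by
  choose! χ hχ using hχ
  have hpair (x : L) (hx : x ∈ S.g0) (b : L) : S.B x (S.br w b) = χ x * S.B w b := by
    rw [← S.B_inv, hχ x hx, map_smul, LinearMap.smul_apply, smul_eq_mul]
  have hbr (b : L) (hb : b ∈ S.g1) : S.br w b = S.B w b • S.br w u := by
    refine sub_eq_zero.1 (S.eq_zero_of_even (S.g0.sub_mem (S.br11 w hw b hb)
      (S.g0.smul_mem _ (S.br11 w hw u hu))) fun x hx => ?_)
    rw [map_sub, map_smul, hpair x hx, hpair x hx, hwu, smul_eq_mul]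
    ring
  have hww : S.br w w = 0 := by
    rw [hbr w hw, self_eq_neg.1 (S.B_alt w hw w hw), zero_smul]
  have hz : S.br w u ∈ S.g0 := S.br11 w hw u hu
  have hwz : S.br w (S.br w u) = 0 := by
    have h := S.jac_oo w hw w hw u
    rw [hww, map_zero, LinearMap.zero_apply, zero_sub] at h
    exact eq_zero_of_eq_neg h
  have hzw : S.br (S.br w u) w = 0 := by rw [S.skew_e _ hz, hwz, neg_zero]
  have hcomm (x : L) (hx : x ∈ S.g0) : S.br (S.br w u) x = 0 := by
    have hxz : S.br x (S.br w u) = 0 := by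
      refine S.eq_zero_of_even (S.br00 x hx _ hz) fun y hy => ?_
      have h := S.jac_e y hy x w
      rw [hχ x hx, hχ y hy, map_smul, map_smul, hχ x hx, hχ y hy, smul_comm, right_eq_add] at h
      rw [← S.B_inv, ← S.B_inv, h, map_zero, LinearMap.zero_apply]
    rw [S.skew_e _ hz, hxz, neg_zero]
  have hsq (b : L) (hb : b ∈ S.g1) : S.br (S.br w u) (S.br (S.br w u) b)
      = -(S.B w b • S.br (S.br w u) (S.br (S.br w u) u)) := by
    have hub := S.br11 u hu b hb
    have h : S.br (S.br w u) b = -(χ (S.br u b) • w) - S.B w b • S.br (S.br w u) u := by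
      have h1 := S.jac_oo w hw u hu b
      have h2 : S.br w (S.br u b) = -(χ (S.br u b) • w) := by
        rw [← hχ _ hub, S.skew_e _ hub, neg_neg]
      rw [h2, hbr b hb, map_smul, ← neg_neg (S.br u (S.br w u)), ← S.skew_e _ hz, smul_neg,
        sub_neg_eq_add] at h1
      rw [h1, add_sub_cancel_right]
    conv_lhs => rw [h]
    rw [map_sub, map_neg, map_smul, map_smul, hzw, smul_zero, neg_zero, zero_sub]
  have hsqu : S.br (S.br w u) (S.br (S.br w u) u) = 0 := by
    have h := hsq u hu
    rw [hwu, one_smul] at h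
    exact eq_zero_of_eq_neg h
  refine S.br_eq_zero_of_sq_eq_zero hz hcomm (fun b => ?_) a
  obtain ⟨b0, hb0, b1, hb1, rfl⟩ := Submodule.mem_sup.1
    (S.compl.sup_eq_top ▸ Submodule.mem_top : b ∈ S.g0 ⊔ S.g1)
  rw [map_add, map_add, hcomm b0 hb0, map_zero, zero_add, hsq b1 hb1, hsqu, smul_zero, neg_zero]

/-- An odd vector spanning a one-dimensional `g0`-submodule is centralized by the even part of the
derived subalgebra. -/
theorem br_odd_eq_zero [FiniteDimensional ℂ L] {w : L} (hw : w ∈ S.g1)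
    (hχ : ∀ x ∈ S.g0, ∃ c : ℂ, S.br x w = c • w) {t : L} (ht : t ∈ S.g0)
    (htd : t ∈ S.derived) : S.br t w = 0 := by
  by_cases hw0 : w = 0
  · rw [hw0, map_zero]
  obtain ⟨u, hu, hwu⟩ := S.exists_odd_pairing_eq_one hw hw0
  have hz : S.br w u ∈ S.g0 := S.br11 w hw u hu
  have hBt : S.B t (S.br w u) = 0 := by
    suffices S.derived ≤ LinearMap.ker (S.B.flip (S.br w u)) from LinearMap.mem_ker.1 (this htd)
    refine Submodule.span_le.2 ?_
    rintro _ ⟨p, -, q, -, rfl⟩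
    have hq : S.br q (S.br w u) = 0 := by
      rw [← neg_eq_zero, ← S.skew_e _ hz q, S.br_br_odd_eq_zero hw hu hwu hχ]
    rw [SetLike.mem_coe, LinearMap.mem_ker, LinearMap.flip_apply, S.B_inv, hq, map_zero]
  obtain ⟨c, hc⟩ := hχ t ht
  rw [← S.B_inv, hc, map_smul, LinearMap.smul_apply, hwu, smul_eq_mul, mul_one] at hBt
  rw [hc, hBt, zero_smul]

end BasicSuperData

namespace SuperData

/-- If `g0` acts on a vector by scalars, the same scalars give its action on the homogeneous
components of the vector. -/
theorem br_add_eq_smul_add {L : Type*} [AddCommGroup L] [Module ℂ L] (S : SuperData L)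
    {w0 w1 x : L} {c : ℂ} (hw0 : w0 ∈ S.g0) (hw1 : w1 ∈ S.g1) (hx : x ∈ S.g0)
    (hc : S.br x (w0 + w1) = c • (w0 + w1)) : S.br x w0 = c • w0 ∧ S.br x w1 = c • w1 := by
  have heq : S.br x w0 - c • w0 = c • w1 - S.br x w1 := by
    rw [map_add, smul_add] at hc
    rw [sub_eq_sub_iff_add_eq_add, hc, add_comm]
  have h0 : S.br x w0 - c • w0 = 0 := Submodule.disjoint_def.1 S.compl.disjoint _
    (S.g0.sub_mem (S.br00 x hx w0 hw0) (S.g0.smul_mem c hw0))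
    (heq ▸ S.g1.sub_mem (S.g1.smul_mem c hw1) (S.br01 x hx w1 hw1))
  exact ⟨sub_eq_zero.1 h0, (sub_eq_zero.1 (heq ▸ h0)).symm⟩

end SuperData

/-- let `g` be a finite-dimensional complex Lie superalgebra of
basic type, `h` a Cartan subalgebra of `g0`. If `W = V(λ)` is a
one-dimensional `g0`-submodule of `g` appearing in the decomposition of `g`
into irreducible `g0`-modules, with `h`-weight `λ`, then `λ` vanishes on
`h' = h ∩ [g,g]`. -/
theorem one_dimensional_summand_weight_vanishes
    {L : Type*} [AddCommGroup L] [Module ℂ L] [FiniteDimensional ℂ L]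
    (S : BasicSuperData L) (h : Submodule ℂ L) (hh : S.IsCartan h)
    (W : Submodule ℂ L) (hdim : Module.finrank ℂ ↥W = 1)
    (hmod : ∀ x ∈ S.g0, ∀ w ∈ W, S.br x w ∈ W)
    (lam : Module.Dual ℂ L)
    (hwt : ∀ t ∈ h, ∀ w ∈ W, S.br t w = lam t • w) :
    ∀ t ∈ h ⊓ S.derived, lam t = 0 := by
  rintro t ⟨hth, htd⟩
  have ht : t ∈ S.g0 := hh.1 hth
  obtain ⟨⟨w, hwW⟩, hw, hspan⟩ := finrank_eq_one_iff'.1 hdim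
  have hχ (x : L) (hx : x ∈ S.g0) : ∃ c : ℂ, S.br x w = c • w := by
    obtain ⟨c, hc⟩ := hspan ⟨S.br x w, hmod x hx w hwW⟩
    exact ⟨c, (congrArg Subtype.val hc).symm⟩
  have htw := hwt t hth w hwW
  obtain ⟨w0, hw0, w1, hw1, rfl⟩ := Submodule.mem_sup.1
    (S.compl.sup_eq_top ▸ Submodule.mem_top : w ∈ S.g0 ⊔ S.g1)
  have h0 : S.br t w0 = 0 := S.br_even_eq_zero hw0 (fun x hx => (hχ x hx).imp fun _ hc =>
    (S.br_add_eq_smul_add hw0 hw1 hx hc).1) ht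
  have h1 : S.br t w1 = 0 := S.br_odd_eq_zero hw1 (fun x hx => (hχ x hx).imp fun _ hc =>
    (S.br_add_eq_smul_add hw0 hw1 hx hc).2) ht htd
  rw [map_add, h0, h1, add_zero] at htw
  exact (smul_eq_zero.1 htw.symm).resolve_right fun hzero => hw (Subtype.ext hzero)
end
end

section
/- Let g be a finite-dimensional complex Lie superalgebra of basic type. Set g^{(1)} = [g,g] and g^{(2)} = [g^{(1)}, g^{(1)}]. Then the radical of the restriction of the invariant bilinear form to g^{(2)} equals 𝔷(g) ∩ g^{(2)}, where 𝔷(g) is the center of g. -/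
open scoped BigOperators Classical
open Module

noncomputable section

namespace SuperData

variable {L : Type*} [AddCommGroup L] [Module ℂ L] (S : SuperData L)

theorem br_mem_brSpan {P Q : Submodule ℂ L} {x y : L} (hx : x ∈ P) (hy : y ∈ Q) :
    S.br x y ∈ S.brSpan P Q :=
  Submodule.subset_span ⟨x, hx, y, hy, rfl⟩

theorem brSpan_le {P Q W : Submodule ℂ L} (h : ∀ x ∈ P, ∀ y ∈ Q, S.br x y ∈ W) :
    S.brSpan P Q ≤ W := by
  refine Submodule.span_le.2 ?_
  rintro _ ⟨x, hx, y, hy, rfl⟩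
  exact h x hx y hy

theorem br_mem_derived (x y : L) : S.br x y ∈ S.derived :=
  S.br_mem_brSpan Submodule.mem_top Submodule.mem_top

theorem br_mem_derived2 {x y : L} (hx : x ∈ S.derived) (hy : y ∈ S.derived) :
    S.br x y ∈ S.derived2 :=
  S.br_mem_brSpan hx hy

theorem mem_center {x : L} : x ∈ S.center ↔ ∀ y, S.br x y = 0 := by
  simp [center, Submodule.mem_iInf]

theorem br_even_center {x z : L} (hx : x ∈ S.g0) (hz : z ∈ S.center) : S.br x z = 0 := by
  rw [S.skew_e x hx, S.mem_center.1 hz, neg_zero]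

theorem exists_even_add_odd (x : L) : ∃ x0 ∈ S.g0, ∃ x1 ∈ S.g1, x0 + x1 = x :=
  Submodule.mem_sup.1 (S.compl.sup_eq_top ▸ Submodule.mem_top)

theorem derived_le_even_sup_odd : S.derived ≤ S.derived ⊓ S.g0 ⊔ S.derived ⊓ S.g1 := by
  refine S.brSpan_le fun x _ y _ => ?_
  obtain ⟨x0, hx0, x1, hx1, rfl⟩ := S.exists_even_add_odd x
  obtain ⟨y0, hy0, y1, hy1, rfl⟩ := S.exists_even_add_odd y
  have h : S.br (x0 + x1) (y0 + y1) =
      (S.br x0 y0 + S.br x1 y1) + (S.br x0 y1 + S.br x1 y0) := by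
    simp only [map_add, LinearMap.add_apply]; abel
  rw [h]
  exact Submodule.add_mem_sup
    ⟨add_mem (S.br_mem_derived _ _) (S.br_mem_derived _ _),
      add_mem (S.br00 _ hx0 _ hy0) (S.br11 _ hx1 _ hy1)⟩
    ⟨add_mem (S.br_mem_derived _ _) (S.br_mem_derived _ _),
      add_mem (S.br01 _ hx0 _ hy1) (S.br10 _ hx1 _ hy0)⟩

/-- The odd part of `g⁽²⁾` is generated by brackets of even with arbitrary elements of `g⁽¹⁾`. -/
theorem derived2_le_even_sup_odd {W : Submodule ℂ L}
    (hW : ∀ u ∈ S.derived ⊓ S.g0, ∀ v, S.br u v ∈ W) :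
    S.derived2 ≤ S.derived2 ⊓ S.g0 ⊔ S.derived2 ⊓ (S.g1 ⊓ W) := by
  refine S.brSpan_le fun x hx y hy => ?_
  obtain ⟨x0, hx0, x1, hx1, rfl⟩ := Submodule.mem_sup.1 (S.derived_le_even_sup_odd hx)
  obtain ⟨y0, hy0, y1, hy1, rfl⟩ := Submodule.mem_sup.1 (S.derived_le_even_sup_odd hy)
  have h : S.br (x0 + x1) (y0 + y1) =
      (S.br x0 y0 + S.br x1 y1) + (S.br x0 y1 - S.br y0 x1) := by
    rw [S.skew_e y0 hy0.2 x1]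
    simp only [map_add, LinearMap.add_apply]; abel
  rw [h]
  exact Submodule.add_mem_sup
    ⟨add_mem (S.br_mem_derived2 hx0.1 hy0.1) (S.br_mem_derived2 hx1.1 hy1.1),
      add_mem (S.br00 _ hx0.2 _ hy0.2) (S.br11 _ hx1.2 _ hy1.2)⟩
    ⟨sub_mem (S.br_mem_derived2 hx0.1 hy1.1) (S.br_mem_derived2 hy0.1 hx1.1),
      sub_mem (S.br01 _ hx0.2 _ hy1.2) (S.br01 _ hy0.2 _ hx1.2),
      sub_mem (hW _ hx0 _) (hW _ hy0 _)⟩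

theorem br_even_mem_derived2 {c y : L} (hc : c ∈ S.g0) (hy : y ∈ S.derived2) :
    S.br c y ∈ S.derived2 := by
  refine S.brSpan_le (W := S.derived2.comap (S.br c)) (fun p hp q hq => ?_) hy
  rw [Submodule.mem_comap, S.jac_e c hc]
  exact add_mem (S.br_mem_derived2 (S.br_mem_derived _ _) hq)
    (S.br_mem_derived2 hp (S.br_mem_derived _ _))

/-- The common kernel of the operators `[u, ·]`, `u ∈ U`. -/
def annihilated (U : Submodule ℂ L) : Submodule ℂ L := ⨅ u : U, LinearMap.ker (S.br (u : L))

theorem mem_annihilated {U : Submodule ℂ L} {v : L} :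
    v ∈ S.annihilated U ↔ ∀ u ∈ U, S.br u v = 0 := by
  simp [annihilated, Submodule.mem_iInf]

theorem br_mem_annihilated {U : Submodule ℂ L} (hU0 : U ≤ S.g0)
    (hU : ∀ c ∈ S.g0, ∀ u ∈ U, S.br c u ∈ U) {c v : L} (hc : c ∈ S.g0)
    (hv : v ∈ S.annihilated U) : S.br c v ∈ S.annihilated U := by
  rw [mem_annihilated] at hv ⊢
  intro u hu
  rw [S.jac_e u (hU0 hu), S.skew_e u (hU0 hu) c, hv u hu, map_neg, LinearMap.neg_apply,
    hv _ (hU c hc u hu), neg_zero, map_zero, add_zero]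

end SuperData

namespace QuadSuperData

variable {L : Type*} [AddCommGroup L] [Module ℂ L] (S : QuadSuperData L)

theorem B_center_derived2 {x y : L} (hx : x ∈ S.center) (hy : y ∈ S.derived2) : S.B x y = 0 := by
  refine S.brSpan_le (W := LinearMap.ker (S.B x)) (fun p _ q _ => ?_) hy
  rw [LinearMap.mem_ker, ← S.B_inv, S.mem_center.1 hx, map_zero, LinearMap.zero_apply]

theorem mem_center_of_B_derived {x : L} (h : ∀ y ∈ S.derived, S.B x y = 0) : x ∈ S.center := by
  refine S.mem_center.2 fun y => S.B_nondeg _ fun z => ?_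
  rw [S.B_inv, h _ (S.br_mem_derived _ _)]

theorem br_mem_center_of_B_derived2 {x u : L} (h : ∀ y ∈ S.derived2, S.B x y = 0)
    (hu : u ∈ S.derived) : S.br x u ∈ S.center := by
  refine S.mem_center_of_B_derived fun v hv => ?_
  rw [S.B_inv, h _ (S.br_mem_derived2 hu hv)]

/-- `B_ortho` only gives orthogonality with the even vector on the left; invariance gives the other
order on `g⁽¹⁾`. -/
theorem B_odd_even_of_mem_derived {x y : L} (hx : x ∈ S.g1) (hy : y ∈ S.derived)
    (hy0 : y ∈ S.g0) : S.B x y = 0 := by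
  have key : S.derived ≤ S.g0 ⊓ LinearMap.ker (S.B x) ⊔ S.g1 := by
    refine S.brSpan_le fun a _ b _ => ?_
    obtain ⟨a0, ha0, a1, ha1, rfl⟩ := S.exists_even_add_odd a
    obtain ⟨b0, hb0, b1, hb1, rfl⟩ := S.exists_even_add_odd b
    have h : S.br (a0 + a1) (b0 + b1) =
        (S.br a0 b0 + S.br a1 b1) + (S.br a0 b1 + S.br a1 b0) := by
      simp only [map_add, LinearMap.add_apply]; abel
    rw [h]
    refine Submodule.add_mem_sup
      ⟨add_mem (S.br00 _ ha0 _ hb0) (S.br11 _ ha1 _ hb1), ?_⟩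
      (add_mem (S.br01 _ ha0 _ hb1) (S.br10 _ ha1 _ hb0))
    have h00 : S.B x (S.br a0 b0) = 0 := by
      have hskew : S.br x a0 = -S.br a0 x := by rw [S.skew_e a0 ha0, neg_neg]
      rw [← S.B_inv, hskew, map_neg, LinearMap.neg_apply, S.B_inv,
        S.B_ortho _ ha0 _ (S.br10 _ hx _ hb0), neg_zero]
    have h11 : S.B x (S.br a1 b1) = 0 := by
      rw [← S.B_inv, S.B_ortho _ (S.br11 _ hx _ ha1) _ hb1]
    exact add_mem (LinearMap.mem_ker.2 h00) (LinearMap.mem_ker.2 h11)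
  obtain ⟨y0, hy0', y1, hy1, rfl⟩ := Submodule.mem_sup.1 (key hy)
  have hy1' : y1 = 0 :=
    Submodule.disjoint_def.1 S.compl.disjoint _ ((Submodule.add_mem_iff_right _ hy0'.1).1 hy0) hy1
  rw [hy1', add_zero]
  exact hy0'.2

/-- The even part of the left orthogonal of `g⁽²⁾`. -/
def evenOrtho : Submodule ℂ L := S.g0 ⊓ ⨅ y : S.derived2, LinearMap.ker (S.B.flip (y : L))

theorem mem_evenOrtho {x : L} :
    x ∈ S.evenOrtho ↔ x ∈ S.g0 ∧ ∀ y ∈ S.derived2, S.B x y = 0 := by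
  simp [evenOrtho, Submodule.mem_iInf]

theorem br_mem_evenOrtho {c x : L} (hc : c ∈ S.g0) (hx : x ∈ S.evenOrtho) :
    S.br c x ∈ S.evenOrtho := by
  rw [mem_evenOrtho] at hx ⊢
  refine ⟨S.br00 _ hc _ hx.1, fun y hy => ?_⟩
  rw [S.skew_e c hc, map_neg, LinearMap.neg_apply, S.B_inv,
    hx.2 _ (S.br_even_mem_derived2 hc hy), neg_zero]

end QuadSuperData

namespace BasicSuperData

variable {L : Type*} [AddCommGroup L] [Module ℂ L] (S : BasicSuperData L)

/-- Complete reducibility splits off the kernel of an ideal `U` of `g0`; the complement contains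
`[U, g]`. -/
theorem exists_isCompl_annihilated {U : Submodule ℂ L} (hU0 : U ≤ S.g0)
    (hU : ∀ c ∈ S.g0, ∀ u ∈ U, S.br c u ∈ U) :
    ∃ W : Submodule ℂ L, IsCompl (S.annihilated U) W ∧ ∀ u ∈ U, ∀ v, S.br u v ∈ W := by
  obtain ⟨W, hW, hc⟩ := S.reductive (S.annihilated U)
    fun c hc v hv => S.br_mem_annihilated hU0 hU hc hv
  refine ⟨W, hc, fun u hu v => ?_⟩
  obtain ⟨z, hz, w, hw, rfl⟩ :=
    Submodule.mem_sup.1 (hc.sup_eq_top ▸ Submodule.mem_top : v ∈ S.annihilated U ⊔ W)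
  rw [map_add, S.mem_annihilated.1 hz u hu, zero_add]
  exact hW u (hU0 hu) w hw

theorem mem_center_of_even {x : L} (hx : x ∈ S.g0) (h : ∀ y ∈ S.derived2, S.B x y = 0) :
    x ∈ S.center := by
  have hU0 : S.evenOrtho ≤ S.g0 := inf_le_left
  obtain ⟨W, hc, hW⟩ := S.exists_isCompl_annihilated hU0
    fun c hc u hu => S.br_mem_evenOrtho hc hu
  have hzero : ∀ u ∈ S.evenOrtho, ∀ v, (∀ u' ∈ S.evenOrtho, S.br u' (S.br u v) = 0) →
      S.br u v = 0 := fun u hu v hv =>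
    Submodule.disjoint_def.1 hc.disjoint _ (S.mem_annihilated.2 hv) (hW u hu v)
  refine S.mem_center.2 fun v => ?_
  refine hzero x (S.mem_evenOrtho.2 ⟨hx, h⟩) v fun u hu => ?_
  refine hzero u hu _ fun u' hu' => S.br_even_center (hU0 hu') ?_
  exact S.br_mem_center_of_B_derived2 (S.mem_evenOrtho.1 hu).2 (S.br_mem_derived _ _)

end BasicSuperData

/-- for a finite-dimensional complex Lie superalgebra of basic
type, the radical of the restriction of the invariant form to
`g⁽²⁾ = [[g,g],[g,g]]` equals `𝔷(g) ∩ g⁽²⁾`. -/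
theorem radical_restriction_eq_center_inter
    {L : Type*} [AddCommGroup L] [Module ℂ L] [FiniteDimensional ℂ L]
    (S : BasicSuperData L) :
    ∀ x ∈ S.derived2, ((∀ y ∈ S.derived2, S.B x y = 0) ↔ x ∈ S.center) := by
  intro x hx
  refine ⟨fun h => ?_, fun h y hy => S.B_center_derived2 h hy⟩
  have hU0 : S.derived ⊓ S.g0 ≤ S.g0 := inf_le_right
  obtain ⟨W, hc, hW⟩ := S.exists_isCompl_annihilated hU0
    fun c hc u hu => ⟨S.br_mem_derived _ _, S.br00 _ hc _ hu.2⟩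
  have h21 : S.derived2 ≤ S.derived := S.brSpan_le fun p _ q _ => S.br_mem_derived p q
  have hsplit := S.derived2_le_even_sup_odd hW
  obtain ⟨x0, ⟨hx0, hx0e⟩, x1, ⟨hx1, hx1o, hx1W⟩, rfl⟩ := Submodule.mem_sup.1 (hsplit hx)
  have h0 : ∀ y ∈ S.derived2, S.B x0 y = 0 := by
    intro y hy
    obtain ⟨y0, ⟨hy0, hy0e⟩, y1, ⟨hy1, hy1o, -⟩, rfl⟩ := Submodule.mem_sup.1 (hsplit hy)
    have := h y0 hy0
    rw [map_add, LinearMap.add_apply, S.B_odd_even_of_mem_derived hx1o (h21 hy0) hy0e,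
      add_zero] at this
    rw [map_add, this, S.B_ortho _ hx0e _ hy1o, add_zero]
  have h1 : ∀ y ∈ S.derived2, S.B x1 y = 0 := by
    intro y hy
    simpa [h0 y hy] using h y hy
  have hx1Z : x1 ∈ S.annihilated (S.derived ⊓ S.g0) := by
    refine S.mem_annihilated.2 fun u hu => ?_
    refine Submodule.disjoint_def.1 hc.disjoint _ (S.mem_annihilated.2 fun u' hu' => ?_)
      (hW u hu x1)
    refine S.br_even_center hu'.2 ?_
    rw [S.skew_e u hu.2]
    exact neg_mem (S.br_mem_center_of_B_derived2 h1 hu.1)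
  rw [Submodule.disjoint_def.1 hc.disjoint _ hx1Z hx1W, add_zero]
  exact S.mem_center_of_even hx0e h0
end
end
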